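/- arXiv:1411.6160 — 6 statements merged into one kernel-verified Lean document; each statement's English description precedes it below -/
import Mathlib

section
/- Let g : ℝ^m → ℝ be a seminorm that is not identically zero, let h : ℝ^n → ℝ be a norm, and let λ > 0. Then for every z ∈ ℝ^m and every β ∈ ℝ^n, the supremum of g(z + Δβ) over all matrices Δ ∈ ℝ^{m×n} satisfying g(Δx) ≤ λ·h(x) for all x ∈ ℝ^n equals g(z) + λ·h(β), and this supremum is attained. -/
open scoped ENNReal

noncomputable def lpNorm (p : ℝ≥0∞) {ι : Type*} [Fintype ι] (x : ι → ℝ) : ℝ :=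
  ‖(WithLp.equiv p (ι → ℝ)).symm x‖

noncomputable def frobNorm (p : ℝ≥0∞) {m n : ℕ} (A : Matrix (Fin m) (Fin n) ℝ) : ℝ :=
  lpNorm p (fun ij : Fin m × Fin n => A ij.1 ij.2)

noncomputable def discrep (m : ℕ) (a b : ℝ≥0∞) : ℝ :=
  sSup {t : ℝ | ∃ u : Fin m → ℝ, lpNorm b u = 1 ∧ t = lpNorm a u}

/-- Every vector is normed by a linear functional dominated by a given norm-like function. -/
theorem exists_linear_le_eq_apply {E : Type*} [AddCommGroup E] [Module ℝ E] (h : E → ℝ)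
    (hom : ∀ (a : ℝ) (x : E), h (a • x) = |a| * h x)
    (tri : ∀ x y : E, h (x + y) ≤ h x + h y) (nonneg : ∀ x, 0 ≤ h x) (v : E) :
    ∃ φ : E →ₗ[ℝ] ℝ, φ v = h v ∧ ∀ x, |φ x| ≤ h x := by
  by_cases hv : v = 0
  · subst hv
    exact ⟨0, by simpa using (hom 0 0).symm, fun x => by simpa using nonneg x⟩
  obtain ⟨φ, hφ, hle⟩ := exists_extension_of_le_sublinear
    (LinearPMap.mkSpanSingleton v (h v) hv) h
    (fun c hc x => by rw [hom, abs_of_pos hc]) tri (by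
      rintro ⟨x, hx⟩
      obtain ⟨c, rfl⟩ := Submodule.mem_span_singleton.mp hx
      rw [LinearPMap.mkSpanSingleton'_apply, hom, smul_eq_mul]
      exact mul_le_mul_of_nonneg_right (le_abs_self c) (nonneg v))
  refine ⟨φ, ?_, fun x => abs_le.mpr ⟨?_, hle x⟩⟩
  · have hmem : v ∈ Submodule.span ℝ {v} :=
      Submodule.mem_span_singleton_self v
    rw [hφ ⟨v, hmem⟩]
    exact LinearPMap.mkSpanSingleton'_apply_self _ _ _ _
  · have h1 := hle (-x)
    have h2 := hom (-1) x
    simp only [neg_one_smul, abs_neg, abs_one, one_mul] at h2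
    rw [map_neg, h2] at h1
    linarith

/-- For a nonzero seminorm, some unit direction attains equality in the triangle inequality
at `z`. -/
theorem exists_unit_add_smul_eq {E : Type*} [AddCommGroup E] [Module ℝ E] (g : E → ℝ)
    (hom : ∀ (a : ℝ) (x : E), g (a • x) = |a| * g x)
    (tri : ∀ x y : E, g (x + y) ≤ g x + g y) (nonneg : ∀ x, 0 ≤ g x)
    (ne : ∃ x, g x ≠ 0) (z : E) :
    ∃ w, g w = 1 ∧ ∀ t : ℝ, 0 ≤ t → g (z + t • w) = g z + t := by
  have normalize (u : E) (hu : g u ≠ 0) : g ((g u)⁻¹ • u) = 1 := by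
    rw [hom, abs_of_nonneg (inv_nonneg.mpr (nonneg u)), inv_mul_cancel₀ hu]
  by_cases hz : g z = 0
  · obtain ⟨u, hu⟩ := ne
    refine ⟨(g u)⁻¹ • u, normalize u hu, fun t ht => ?_⟩
    generalize hw : (g u)⁻¹ • u = w
    have hw1 : g (t • w) = t := by
      rw [hom, ← hw, normalize u hu, abs_of_nonneg ht, mul_one]
    have h1 := tri z (t • w)
    have h2 := tri (z + t • w) ((-1 : ℝ) • z)
    have h3 : z + t • w + (-1 : ℝ) • z = t • w := by module
    rw [h3, hom (-1) z, hz] at h2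
    linarith
  · refine ⟨(g z)⁻¹ • z, normalize z hz, fun t ht => ?_⟩
    have h1 : z + t • (g z)⁻¹ • z = (1 + t * (g z)⁻¹) • z := by module
    have h2 : 0 ≤ 1 + t * (g z)⁻¹ := by have := nonneg z; positivity
    rw [h1, hom, abs_of_nonneg h2]
    field_simp

/-- An absolutely homogeneous subadditive function is nonnegative. -/
theorem nonneg_of_abs_homogeneous {E : Type*} [AddCommGroup E] [Module ℝ E] (g : E → ℝ)
    (hom : ∀ (a : ℝ) (x : E), g (a • x) = |a| * g x)
    (tri : ∀ x y : E, g (x + y) ≤ g x + g y) (x : E) : 0 ≤ g x :=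
  apply_nonneg (Seminorm.of g tri hom) x

/-- Robustification under induced (h,g) uncertainty equals regularization, and the
supremum is attained. -/
theorem stmt0 {m n : ℕ} (g : (Fin m → ℝ) → ℝ) (h : (Fin n → ℝ) → ℝ) (lam : ℝ)
    (hlam : 0 < lam)
    (hg_homog : ∀ (a : ℝ) (x : Fin m → ℝ), g (a • x) = |a| * g x)
    (hg_tri : ∀ x y : Fin m → ℝ, g (x + y) ≤ g x + g y)
    (hg_ne : ∃ x : Fin m → ℝ, g x ≠ 0)
    (hh_homog : ∀ (a : ℝ) (x : Fin n → ℝ), h (a • x) = |a| * h x)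
    (hh_tri : ∀ x y : Fin n → ℝ, h (x + y) ≤ h x + h y)
    (hh_def : ∀ x : Fin n → ℝ, h x = 0 → x = 0)
    (z : Fin m → ℝ) (β : Fin n → ℝ) :
    IsGreatest
      {t : ℝ | ∃ Δ : Matrix (Fin m) (Fin n) ℝ,
        (∀ x : Fin n → ℝ, g (Δ.mulVec x) ≤ lam * h x) ∧ t = g (z + Δ.mulVec β)}
      (g z + lam * h β) := by
  have hg0 := nonneg_of_abs_homogeneous g hg_homog hg_tri
  have hh0 := nonneg_of_abs_homogeneous h hh_homog hh_tri
  constructor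
  · obtain ⟨φ, hφβ, hφ⟩ := exists_linear_le_eq_apply h hh_homog hh_tri hh0 β
    obtain ⟨w, hw, hzw⟩ := exists_unit_add_smul_eq g hg_homog hg_tri hg0 hg_ne z
    refine ⟨LinearMap.toMatrix' ((lam • φ).smulRight w), fun x => ?_, ?_⟩
    · rw [LinearMap.toMatrix'_mulVec, LinearMap.smulRight_apply, hg_homog, hw,
        LinearMap.smul_apply, smul_eq_mul, abs_mul, abs_of_pos hlam, mul_one]
      exact mul_le_mul_of_nonneg_left (hφ x) hlam.le
    · rw [LinearMap.toMatrix'_mulVec, LinearMap.smulRight_apply, LinearMap.smul_apply, hφβ,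
        smul_eq_mul, hzw _ (mul_nonneg hlam.le (hh0 β))]
  · rintro t ⟨Δ, hΔ, rfl⟩
    linarith [hg_tri z (Δ.mulVec β), hΔ β]
end

section
/- Fix λ > 0 and p ∈ [1,∞]. Define three sets of matrices in ℝ^{m×n}: U = {Δ : ‖Δx‖₂ ≤ λ‖x‖₁ for all x ∈ ℝ^n}; U' = {Δ : ‖Δβ‖₂ ≤ λ‖β‖₀ for all β ∈ ℝ^n with ‖β‖_p ≤ 1}; and U'' = {Δ : ‖Δ_i‖₂ ≤ λ for every column Δ_i of Δ}. Then U = U' = U''. -/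
open scoped ENNReal

lemma lpNorm_one {ι : Type*} [Fintype ι] (x : ι → ℝ) : lpNorm 1 x = ∑ i, |x i| := by
  simp [lpNorm, PiLp.norm_eq_of_L1]

lemma lpNorm_single (p : ℝ≥0∞) (hp : 1 ≤ p) {ι : Type*} [Fintype ι] [DecidableEq ι] (i : ι) :
    lpNorm p (Pi.single i (1 : ℝ)) = 1 := by
  have : Fact (1 ≤ p) := ⟨hp⟩
  simp [lpNorm]

lemma abs_apply_le_lpNorm (p : ℝ≥0∞) (hp : 1 ≤ p) {ι : Type*} [Fintype ι] (x : ι → ℝ) (i : ι) :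
    |x i| ≤ lpNorm p x := by
  have : Fact (1 ≤ p) := ⟨hp⟩
  exact PiLp.norm_apply_le (WithLp.toLp p x) i

lemma lpNorm_mulVec_le {m n : ℕ} (p : ℝ≥0∞) (hp : 1 ≤ p) (A : Matrix (Fin m) (Fin n) ℝ)
    (x : Fin n → ℝ) : lpNorm p (A.mulVec x) ≤ ∑ i, |x i| * lpNorm p (fun j => A j i) := by
  have : Fact (1 ≤ p) := ⟨hp⟩
  have h : WithLp.toLp p (A.mulVec x) = ∑ i, x i • WithLp.toLp p (fun j => A j i) := by
    ext j
    simp [Matrix.mulVec, dotProduct, mul_comm]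
  change ‖WithLp.toLp p (A.mulVec x)‖ ≤ _
  rw [h]
  refine (norm_sum_le _ _).trans_eq (Finset.sum_congr rfl fun i _ => ?_)
  rw [norm_smul, Real.norm_eq_abs]
  rfl

lemma sum_abs_le_card_support {ι : Type*} [Fintype ι] (x : ι → ℝ) (hx : ∀ i, |x i| ≤ 1) :
    ∑ i, |x i| ≤ (Nat.card {i // x i ≠ 0} : ℝ) := by
  classical
  rw [Nat.card_eq_fintype_card, Fintype.card_subtype, Finset.card_filter]
  push_cast
  refine Finset.sum_le_sum fun i _ => ?_
  split_ifs with h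
  · exact hx i
  · simp [not_not.mp h]

lemma card_support_single {ι : Type*} [DecidableEq ι] (i : ι) :
    Nat.card {j // (Pi.single i (1 : ℝ) : ι → ℝ) j ≠ 0} = 1 := by
  simp [Pi.single_apply]

/-- The induced (1,2) uncertainty set coincides with the ℓ₀-induced uncertainty set
and with the columnwise-ℓ₂-ball uncertainty set. -/
theorem stmt4 {m n : ℕ} (lam : ℝ) (hlam : 0 < lam) (p : ℝ≥0∞) (hp : 1 ≤ p) :
    ({Δ : Matrix (Fin m) (Fin n) ℝ |
        ∀ x : Fin n → ℝ, lpNorm 2 (Δ.mulVec x) ≤ lam * lpNorm 1 x} =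
      {Δ : Matrix (Fin m) (Fin n) ℝ | ∀ β : Fin n → ℝ, lpNorm p β ≤ 1 →
        lpNorm 2 (Δ.mulVec β) ≤ lam * (Nat.card {i : Fin n // β i ≠ 0} : ℝ)}) ∧
    ({Δ : Matrix (Fin m) (Fin n) ℝ |
        ∀ x : Fin n → ℝ, lpNorm 2 (Δ.mulVec x) ≤ lam * lpNorm 1 x} =
      {Δ : Matrix (Fin m) (Fin n) ℝ | ∀ i : Fin n, lpNorm 2 (fun j => Δ j i) ≤ lam}) := by
  have col_of_single (Δ : Matrix (Fin m) (Fin n) ℝ) (i : Fin n) :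
      Δ.mulVec (Pi.single i 1) = fun j => Δ j i := by
    ext j
    simp
  have le_of_col (Δ : Matrix (Fin m) (Fin n) ℝ)
      (h : ∀ i : Fin n, lpNorm 2 (fun j => Δ j i) ≤ lam) (x : Fin n → ℝ) :
      lpNorm 2 (Δ.mulVec x) ≤ lam * lpNorm 1 x := by
    refine (lpNorm_mulVec_le 2 one_le_two Δ x).trans ?_
    rw [lpNorm_one, Finset.mul_sum]
    refine Finset.sum_le_sum fun i _ => ?_
    rw [mul_comm]
    exact mul_le_mul_of_nonneg_right (h i) (abs_nonneg _)
  refine ⟨Set.Subset.antisymm (fun Δ h β hβ => (h β).trans ?_) (fun Δ h => le_of_col Δ fun i => ?_),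
    Set.Subset.antisymm (fun Δ h i => ?_) le_of_col⟩
  · rw [lpNorm_one]
    exact mul_le_mul_of_nonneg_left
      (sum_abs_le_card_support β fun i => (abs_apply_le_lpNorm p hp β i).trans hβ) hlam.le
  · simpa only [col_of_single, card_support_single, Nat.cast_one, mul_one] using
      h (Pi.single i 1) (lpNorm_single p hp i).le
  · simpa only [col_of_single, lpNorm_single 1 le_rfl, mul_one] using h (Pi.single i 1)
end

section
/- Fix q ∈ [1,∞] with conjugate exponent q* (1/q + 1/q* = 1), and λ > 0. Let U be the set of matrices Δ ∈ ℝ^{m×n} each of whose rows δ_i satisfies ‖δ_i‖_q ≤ λ. Then for any y ∈ ℝ^m, X ∈ ℝ^{m×n}, and β ∈ ℝ^n, the maximum of ‖y − (X+Δ)β‖₁ over Δ ∈ U equals ‖y − Xβ‖₁ + m·λ‖β‖_{q*}. -/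
open scoped ENNReal

lemma lpNorm_top {ι : Type*} [Fintype ι] (x : ι → ℝ) : lpNorm ⊤ x = ⨆ i, |x i| := by
  simp [lpNorm, PiLp.norm_eq_ciSup]

lemma lpNorm_eq_sum {ι : Type*} [Fintype ι] {p : ℝ≥0∞} (hp : 0 < p.toReal) (x : ι → ℝ) :
    lpNorm p x = (∑ i, |x i| ^ p.toReal) ^ (1 / p.toReal) := by
  simp [lpNorm, PiLp.norm_eq_sum hp]

lemma lpNorm_smul {ι : Type*} [Fintype ι] {p : ℝ≥0∞} (hp : 1 ≤ p) (c : ℝ) (x : ι → ℝ) :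
    lpNorm p (c • x) = |c| * lpNorm p x := by
  have : Fact (1 ≤ p) := ⟨hp⟩
  simp [lpNorm, norm_smul]

lemma lpNorm_nonneg {ι : Type*} [Fintype ι] (p : ℝ≥0∞) (x : ι → ℝ) : 0 ≤ lpNorm p x := by
  rcases p.trichotomy with rfl | rfl | hp
  · simp [lpNorm, PiLp.norm_eq_card]
  · rw [lpNorm_top]
    exact Real.iSup_nonneg fun i => abs_nonneg _
  · rw [lpNorm_eq_sum hp]
    positivity

lemma abs_le_lpNorm_top {ι : Type*} [Fintype ι] (x : ι → ℝ) (i : ι) : |x i| ≤ lpNorm ⊤ x := by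
  rw [lpNorm_top]
  exact le_ciSup (f := fun i => |x i|) (Set.finite_range _).bddAbove i

lemma sum_abs_mul_le_lpNorm_one_mul_lpNorm_top {ι : Type*} [Fintype ι] (x y : ι → ℝ) :
    ∑ i, |x i| * |y i| ≤ lpNorm 1 x * lpNorm ⊤ y := by
  rw [lpNorm_one, Finset.sum_mul]
  gcongr with i
  exact abs_le_lpNorm_top y i

lemma exponent_cases {p q : ℝ≥0∞} (h : 1 / p + 1 / q = 1) :
    (p = 1 ∧ q = ⊤) ∨ (p = ⊤ ∧ q = 1) ∨ p.toReal.HolderConjugate q.toReal := by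
  rw [one_div, one_div] at h
  have : p.HolderConjugate q := ENNReal.holderConjugate_iff.2 h
  rcases eq_or_ne p ⊤ with rfl | hp
  · right; left
    simpa using h
  rcases eq_or_ne q ⊤ with rfl | hq
  · left
    simpa using h
  exact .inr (.inr (ENNReal.HolderConjugate.toReal_of_ne_top hp hq))

/-- Hölder's inequality. -/
lemma abs_dotProduct_le_lpNorm_mul_lpNorm {ι : Type*} [Fintype ι] {p q : ℝ≥0∞}
    (h : 1 / p + 1 / q = 1) (x y : ι → ℝ) : |x ⬝ᵥ y| ≤ lpNorm p x * lpNorm q y := by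
  have habs : |x ⬝ᵥ y| ≤ ∑ i, |x i| * |y i| := by
    simpa [dotProduct, abs_mul] using Finset.abs_sum_le_sum_abs (fun i => x i * y i) Finset.univ
  refine habs.trans ?_
  rcases exponent_cases h with ⟨rfl, rfl⟩ | ⟨rfl, rfl⟩ | hpq
  · exact sum_abs_mul_le_lpNorm_one_mul_lpNorm_top x y
  · simpa [mul_comm] using sum_abs_mul_le_lpNorm_one_mul_lpNorm_top y x
  · rw [lpNorm_eq_sum hpq.pos, lpNorm_eq_sum hpq.symm.pos]
    simpa using Real.inner_le_Lp_mul_Lq Finset.univ (fun i => |x i|) (fun i => |y i|) hpq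

lemma exists_abs_eq_one_mul_eq_abs (r : ℝ) : ∃ s : ℝ, |s| = 1 ∧ s * r = |r| := by
  rcases le_total 0 r with h | h
  · exact ⟨1, by simp, by simp [abs_of_nonneg h]⟩
  · exact ⟨-1, by simp, by simp [abs_of_nonpos h]⟩

/-- Hölder's inequality is attained. -/
lemma exists_lpNorm_le_one_dotProduct_eq {ι : Type*} [Fintype ι] {p q : ℝ≥0∞}
    (h : 1 / p + 1 / q = 1) (y : ι → ℝ) :
    ∃ x : ι → ℝ, lpNorm p x ≤ 1 ∧ x ⬝ᵥ y = lpNorm q y := by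
  classical
  choose s hs hsy using fun i => exists_abs_eq_one_mul_eq_abs (y i)
  rcases exponent_cases h with ⟨rfl, rfl⟩ | ⟨rfl, rfl⟩ | hpq
  · rcases isEmpty_or_nonempty ι with hι | hι
    · exact ⟨0, by simp [lpNorm_one], by simp [lpNorm_top]⟩
    · obtain ⟨i, hi⟩ := exists_eq_ciSup_of_finite (f := fun i => |y i|)
      refine ⟨Pi.single i (s i), ?_, ?_⟩
      · rw [lpNorm_one, Finset.sum_eq_single i] <;> simp +contextual [hs]
      · rw [single_dotProduct, hsy, lpNorm_top, hi]
  · refine ⟨s, ?_, ?_⟩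
    · rw [lpNorm_top]
      exact Real.iSup_le (fun i => (hs i).le) zero_le_one
    · simp [dotProduct, hsy, lpNorm_one]
  · obtain ⟨g, hg, hgy⟩ :=
      (NNReal.isGreatest_Lp Finset.univ (fun i => Real.nnabs (y i)) hpq.symm).1
    have hg' : ∑ i, (g i : ℝ) ^ p.toReal ≤ 1 := by exact_mod_cast hg
    refine ⟨fun i => s i * g i, ?_, ?_⟩
    · rw [lpNorm_eq_sum hpq.pos]
      refine Real.rpow_le_one (by positivity) ?_ (by have := hpq.pos; positivity)
      simpa [abs_mul, hs] using hg'
    · rw [lpNorm_eq_sum hpq.symm.pos]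
      have := congrArg NNReal.toReal hgy
      push_cast at this
      rw [← this]
      refine Finset.sum_congr rfl fun i _ => ?_
      rw [← hsy i]
      ring

/-- Robust LAD (ℓ₁) regression under row-wise ℓ_q uncertainty equals ℓ₁ regression
with an m·λ‖β‖_{q*} penalty. -/
theorem stmt5 {m n : ℕ} (q qs : ℝ≥0∞) (hq : 1 ≤ q) (hqs : 1 / q + 1 / qs = 1)
    (lam : ℝ) (hlam : 0 < lam)
    (y : Fin m → ℝ) (X : Matrix (Fin m) (Fin n) ℝ) (β : Fin n → ℝ) :
    IsGreatest
      {t : ℝ | ∃ Δ : Matrix (Fin m) (Fin n) ℝ,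
        (∀ i : Fin m, lpNorm q (Δ i) ≤ lam) ∧
        t = lpNorm 1 (y - (X + Δ).mulVec β)}
      (lpNorm 1 (y - X.mulVec β) + (m : ℝ) * lam * lpNorm qs β) := by
  have hres (Δ : Matrix (Fin m) (Fin n) ℝ) (i : Fin m) :
      (y - (X + Δ).mulVec β) i = (y - X.mulVec β) i - Δ i ⬝ᵥ β := by
    rw [Matrix.add_mulVec, Pi.sub_apply, Pi.add_apply, Pi.sub_apply, ← sub_sub]
    rfl
  have hsum : lpNorm 1 (y - X.mulVec β) + (m : ℝ) * lam * lpNorm qs β =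
      ∑ i, (|(y - X.mulVec β) i| + lam * lpNorm qs β) := by
    rw [lpNorm_one, Finset.sum_add_distrib]
    simp [mul_assoc]
  have hβ : 0 ≤ lpNorm qs β := lpNorm_nonneg qs β
  rw [hsum]
  constructor
  · obtain ⟨u, hu, huβ⟩ := exists_lpNorm_le_one_dotProduct_eq hqs β
    choose s hs hsr using fun i => exists_abs_eq_one_mul_eq_abs ((y - X.mulVec β) i)
    refine ⟨Matrix.of fun i => (-(s i * lam)) • u, fun i => ?_, ?_⟩
    · change lpNorm q ((-(s i * lam)) • u) ≤ lam
      rw [lpNorm_smul hq, abs_neg, abs_mul, hs, one_mul, abs_of_pos hlam]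
      exact mul_le_of_le_one_right hlam.le hu
    · rw [lpNorm_one]
      refine Finset.sum_congr rfl fun i _ => ?_
      have hss : s i * s i = 1 := by rw [← abs_mul_abs_self, hs, one_mul]
      rw [hres]
      change _ = |_ - ((-(s i * lam)) • u) ⬝ᵥ β|
      have hsmul : (y - X.mulVec β) i + s i * (lam * lpNorm qs β) =
          s i * (|(y - X.mulVec β) i| + lam * lpNorm qs β) := by
        linear_combination -(y - X.mulVec β) i * hss + s i * hsr i
      rw [smul_dotProduct, huβ, smul_eq_mul, neg_mul, sub_neg_eq_add, mul_assoc, hsmul, abs_mul, hs,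
        one_mul, abs_of_nonneg (a := |_| + _) (by positivity)]
  · rintro t ⟨Δ, hΔ, rfl⟩
    rw [lpNorm_one]
    refine Finset.sum_le_sum fun i _ => ?_
    rw [hres]
    refine (abs_sub _ _).trans (add_le_add_right ?_ _)
    exact (abs_dotProduct_le_lpNorm_mul_lpNorm hqs _ _).trans
      (mul_le_mul_of_nonneg_right (hΔ i) hβ)
end

section
/- Let ‖·‖ be a norm on the space ℝ^{m×n} of matrices, with dual norm ‖A‖_* = max{⟨A,Δ⟩ : ‖Δ‖ ≤ 1} under the trace inner product. Let f : ℝ^m → ℝ be any function, λ > 0, z ∈ ℝ^m, and β ∈ ℝ^n. Then sup{f(z + Δβ) : Δ ∈ ℝ^{m×n}, ‖Δ‖ ≤ λ} = sup{f(z + u) : u ∈ ℝ^m such that μᵀu ≤ λ‖μβᵀ‖_* for all μ ∈ ℝ^m}. -/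
open scoped ENNReal

/-- The image of a closed ball under a linear map is cut out by its support function. -/
theorem exists_norm_le_map_eq_iff_dotProduct_le {m : ℕ} {E : Type*} [NormedAddCommGroup E]
    [NormedSpace ℝ E] [FiniteDimensional ℝ E] (L : E →ₗ[ℝ] (Fin m → ℝ)) {lam : ℝ}
    (hlam : 0 < lam) (u : Fin m → ℝ) :
    (∃ x, ‖x‖ ≤ lam ∧ L x = u) ↔
      ∀ μ : Fin m → ℝ, μ ⬝ᵥ u ≤ lam * sSup {s : ℝ | ∃ x, ‖x‖ ≤ 1 ∧ s = μ ⬝ᵥ L x} := by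
  have : ProperSpace E := FiniteDimensional.proper ℝ E
  have hL : Continuous L := L.continuous_of_finiteDimensional
  constructor
  · rintro ⟨x, hx, rfl⟩ μ
    have hbdd : BddAbove {s : ℝ | ∃ x, ‖x‖ ≤ 1 ∧ s = μ ⬝ᵥ L x} := by
      have hcont : Continuous fun x => μ ⬝ᵥ L x := by
        unfold dotProduct
        fun_prop
      refine ((isCompact_closedBall (0 : E) 1).image hcont).bddAbove.mono ?_
      rintro s ⟨y, hy, rfl⟩
      exact ⟨y, by simpa using hy, rfl⟩
    have hle : μ ⬝ᵥ L (lam⁻¹ • x) ≤ sSup {s : ℝ | ∃ x, ‖x‖ ≤ 1 ∧ s = μ ⬝ᵥ L x} := by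
      refine le_csSup hbdd ⟨lam⁻¹ • x, ?_, rfl⟩
      rw [norm_smul, Real.norm_of_nonneg (inv_nonneg.2 hlam.le), inv_mul_le_iff₀ hlam]
      simpa using hx
    rw [map_smul, dotProduct_smul, smul_eq_mul, inv_mul_le_iff₀ hlam] at hle
    exact hle
  · intro h
    by_contra hu
    have hnot : u ∉ L '' Metric.closedBall 0 lam := by
      rintro ⟨x, hx, rfl⟩
      exact hu ⟨x, by simpa using hx, rfl⟩
    obtain ⟨g, c, hlt, hgu⟩ := geometric_hahn_banach_closed_point
      ((convex_closedBall (0 : E) lam).linear_image L)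
      ((isCompact_closedBall (0 : E) lam).image hL).isClosed hnot
    have hg (v : Fin m → ℝ) : (fun i => g (Pi.single i 1)) ⬝ᵥ v = g v := by
      have := LinearMap.pi_apply_eq_sum_univ (g : (Fin m → ℝ) →ₗ[ℝ] ℝ) v
      simp only [ContinuousLinearMap.coe_coe, smul_eq_mul] at this
      rw [this, dotProduct]
      refine Finset.sum_congr rfl fun i _ => ?_
      rw [mul_comm]
      congr 2
      ext j
      simp [Pi.single_apply, eq_comm]
    have hle := h fun i => g (Pi.single i 1)
    simp only [hg] at hle
    have hsup : sSup {s : ℝ | ∃ x, ‖x‖ ≤ 1 ∧ s = g (L x)} ≤ c / lam := by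
      refine csSup_le ⟨_, 0, by simp, rfl⟩ ?_
      rintro s ⟨x, hx, rfl⟩
      have hmem : lam • x ∈ Metric.closedBall (0 : E) lam := by
        rw [mem_closedBall_zero_iff, norm_smul, Real.norm_of_nonneg hlam.le]
        exact mul_le_of_le_one_right hlam.le hx
      have := hlt _ ⟨_, hmem, rfl⟩
      rw [map_smul, map_smul, smul_eq_mul] at this
      rw [le_div_iff₀ hlam]
      linarith
    rw [le_div_iff₀ hlam] at hsup
    linarith

open Matrix in
/-- Duality reformulation of the inner maximization of an uncertain regression
problem over a matrix-norm ball. -/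
theorem stmt14 {m n : ℕ} (N : Matrix (Fin m) (Fin n) ℝ → ℝ)
    (hN_homog : ∀ (a : ℝ) (A : Matrix (Fin m) (Fin n) ℝ), N (a • A) = |a| * N A)
    (hN_tri : ∀ A B : Matrix (Fin m) (Fin n) ℝ, N (A + B) ≤ N A + N B)
    (hN_def : ∀ A : Matrix (Fin m) (Fin n) ℝ, N A = 0 → A = 0)
    (f : (Fin m → ℝ) → ℝ) (lam : ℝ) (hlam : 0 < lam)
    (z : Fin m → ℝ) (β : Fin n → ℝ) :
    sSup {t : ℝ | ∃ Δ : Matrix (Fin m) (Fin n) ℝ, N Δ ≤ lam ∧ t = f (z + Δ.mulVec β)} =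
      sSup {t : ℝ | ∃ u : Fin m → ℝ,
        (∀ μ : Fin m → ℝ, (∑ i, μ i * u i) ≤
          lam * sSup {s : ℝ | ∃ Δ : Matrix (Fin m) (Fin n) ℝ, N Δ ≤ 1 ∧
            s = Matrix.trace ((Matrix.vecMulVec μ β)ᵀ * Δ)}) ∧
        t = f (z + u)} := by
  have hN_zero : N 0 = 0 := by simpa using hN_homog 0 0
  have hN_nonneg (A : Matrix (Fin m) (Fin n) ℝ) : 0 ≤ N A := by
    have h₁ := hN_tri A ((-1 : ℝ) • A)
    rw [hN_homog] at h₁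
    simp [hN_zero] at h₁
    exact h₁
  let nrm : Norm (Matrix (Fin m) (Fin n) ℝ) := ⟨N⟩
  have core : NormedSpace.Core ℝ (Matrix (Fin m) (Fin n) ℝ) :=
    { norm_nonneg := hN_nonneg
      norm_smul := hN_homog
      norm_triangle := hN_tri
      norm_eq_zero_iff := fun A => ⟨hN_def A, fun h => h ▸ hN_zero⟩ }
  let _ : NormedAddCommGroup (Matrix (Fin m) (Fin n) ℝ) := NormedAddCommGroup.ofCore core
  let _ : NormedSpace ℝ (Matrix (Fin m) (Fin n) ℝ) := NormedSpace.ofCore core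
  have key (u : Fin m → ℝ) :
      (∃ Δ : Matrix (Fin m) (Fin n) ℝ, N Δ ≤ lam ∧ Δ.mulVec β = u) ↔
        ∀ μ : Fin m → ℝ, μ ⬝ᵥ u ≤ lam * sSup {s : ℝ |
          ∃ Δ : Matrix (Fin m) (Fin n) ℝ, N Δ ≤ 1 ∧ s = μ ⬝ᵥ Δ.mulVec β} :=
    exists_norm_le_map_eq_iff_dotProduct_le
      ((Matrix.mulVecBilin ℝ ℝ).flip β : Matrix (Fin m) (Fin n) ℝ →ₗ[ℝ] (Fin m → ℝ)) hlam u
  have htrace (μ : Fin m → ℝ) (Δ : Matrix (Fin m) (Fin n) ℝ) :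
      Matrix.trace ((Matrix.vecMulVec μ β)ᵀ * Δ) = μ ⬝ᵥ Δ.mulVec β := by
    rw [transpose_vecMulVec, vecMulVec_mul, trace_vecMulVec, dotProduct_comm,
      dotProduct_mulVec]
  simp only [htrace]
  congr 1
  ext t
  constructor
  · rintro ⟨Δ, hΔ, rfl⟩
    exact ⟨_, (key _).1 ⟨Δ, hΔ, rfl⟩, rfl⟩
  · rintro ⟨u, hu, rfl⟩
    obtain ⟨Δ, hΔ, rfl⟩ := (key u).2 hu
    exact ⟨Δ, hΔ, rfl⟩
end

section
/- Let ‖·‖ be a norm on ℝ^{m×n} whose dual norm ‖·‖_* satisfies the separability condition: there exist norms φ on ℝ^m and ψ on ℝ^n with ‖uvᵀ‖_* = φ(u)·ψ(v) for all u ∈ ℝ^m, v ∈ ℝ^n. Let φ* denote the dual norm of φ, f : ℝ^m → ℝ any function, λ > 0, z ∈ ℝ^m, and β ∈ ℝ^n with β ≠ 0. Then sup{f(z + Δβ) : Δ ∈ ℝ^{m×n}, ‖Δ‖ ≤ λ} = sup{f(z + u) : u ∈ ℝ^m, φ*(u) ≤ λ·ψ(β)}. -/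
open scoped ENNReal

open Matrix

/-- The dual norm of a matrix norm N, with respect to the trace inner product. -/
noncomputable def matDualNorm {m n : ℕ} (N : Matrix (Fin m) (Fin n) ℝ → ℝ)
    (A : Matrix (Fin m) (Fin n) ℝ) : ℝ :=
  sSup {t : ℝ | ∃ Δ : Matrix (Fin m) (Fin n) ℝ, N Δ ≤ 1 ∧ t = Matrix.trace (Aᵀ * Δ)}

/-- The dual norm of a vector norm φ. -/
noncomputable def vecDualNorm {k : ℕ} (φ : (Fin k → ℝ) → ℝ) (u : Fin k → ℝ) : ℝ :=
  sSup {t : ℝ | ∃ μ : Fin k → ℝ, φ μ ≤ 1 ∧ t = ∑ i, μ i * u i}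

/-- The sublevel sets of a definite seminorm on a finite-dimensional space are compact. -/
theorem Seminorm.isCompact_setOf_le_of_definite {E : Type*} [NormedAddCommGroup E]
    [NormedSpace ℝ E] [FiniteDimensional ℝ E] (p : Seminorm ℝ E) (hp : ∀ x, p x = 0 → x = 0)
    (r : ℝ) : IsCompact {x | p x ≤ r} := by
  have : ProperSpace E := FiniteDimensional.proper_real E
  have hcont : Continuous p := by
    simpa [continuousOn_univ] using p.convexOn.continuousOn isOpen_univ
  obtain ⟨c, hc, hle⟩ : ∃ c > 0, ∀ x, c * ‖x‖ ≤ p x := by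
    rcases (Metric.sphere (0 : E) 1).eq_empty_or_nonempty with hS | hS
    · refine ⟨1, one_pos, fun x => ?_⟩
      have hx : x = 0 := by
        by_contra hx
        have : ‖x‖⁻¹ • x ∈ Metric.sphere (0 : E) 1 := by simp [norm_smul, hx]
        simp [hS] at this
      simp [hx]
    · obtain ⟨x₀, hx₀, hmin⟩ := (isCompact_sphere (0 : E) 1).exists_isMinOn hS hcont.continuousOn
      refine ⟨p x₀, (apply_nonneg p x₀).lt_of_ne fun h => ?_, fun x => ?_⟩
      · simp [hp x₀ h.symm] at hx₀
      · rcases eq_or_ne x 0 with rfl | hx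
        · simp
        · have hmem : ‖x‖⁻¹ • x ∈ Metric.sphere (0 : E) 1 := by simp [norm_smul, hx]
          have hle : p x₀ ≤ p (‖x‖⁻¹ • x) := hmin hmem
          rw [map_smul_eq_mul, norm_inv, norm_norm] at hle
          have hpos : 0 < ‖x‖ := norm_pos_iff.mpr hx
          calc p x₀ * ‖x‖ ≤ ‖x‖⁻¹ * p x * ‖x‖ := by gcongr
            _ = p x := by field_simp
  refine (isCompact_closedBall (0 : E) (r / c)).of_isClosed_subset
    (isClosed_le hcont continuous_const) fun x hx => ?_
  rw [mem_closedBall_zero_iff, le_div_iff₀ hc, mul_comm]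
  exact (hle x).trans hx

/-- A linear functional is bounded by its dual norm times the norm. -/
theorem Seminorm.linearMap_le_sSup_mul {E : Type*} [NormedAddCommGroup E]
    [NormedSpace ℝ E] [FiniteDimensional ℝ E] (p : Seminorm ℝ E) (hp : ∀ x, p x = 0 → x = 0)
    (L : E →ₗ[ℝ] ℝ) (x : E) : L x ≤ sSup {t | ∃ y, p y ≤ 1 ∧ t = L y} * p x := by
  have hbdd : BddAbove {t | ∃ y, p y ≤ 1 ∧ t = L y} := by
    have himage : {t | ∃ y, p y ≤ 1 ∧ t = L y} = L '' {y | p y ≤ 1} :=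
      Set.ext fun t => by simp [eq_comm]
    rw [himage]
    exact (p.isCompact_setOf_le_of_definite hp 1).bddAbove_image
      L.continuous_of_finiteDimensional.continuousOn
  rcases eq_or_ne x 0 with rfl | hx
  · simp
  · have hpos : 0 < p x := (apply_nonneg p x).lt_of_ne fun h => hx (hp x h.symm)
    rw [← div_le_iff₀ hpos]
    refine le_csSup hbdd ⟨(p x)⁻¹ • x, ?_, ?_⟩
    · rw [map_smul_eq_mul, norm_inv, Real.norm_of_nonneg hpos.le, inv_mul_cancel₀ hpos.ne']
    · rw [map_smul, smul_eq_mul, div_eq_inv_mul]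

theorem Matrix.trace_transpose_vecMulVec_mul {m n : ℕ} (μ : Fin m → ℝ) (β : Fin n → ℝ)
    (Δ : Matrix (Fin m) (Fin n) ℝ) : trace ((vecMulVec μ β)ᵀ * Δ) = ∑ i, μ i * (Δ *ᵥ β) i := by
  rw [transpose_vecMulVec, vecMulVec_mul, trace_vecMulVec, dotProduct_comm, ← dotProduct_mulVec]
  rfl

/-- Under the separability assumption ‖uvᵀ‖_* = φ(u)ψ(v), the inner maximization over
the matrix-norm ball reduces to a maximization over a dual-norm ball in ℝ^m. -/
theorem stmt15 {m n : ℕ} (N : Matrix (Fin m) (Fin n) ℝ → ℝ)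
    (hN_homog : ∀ (a : ℝ) (A : Matrix (Fin m) (Fin n) ℝ), N (a • A) = |a| * N A)
    (hN_tri : ∀ A B : Matrix (Fin m) (Fin n) ℝ, N (A + B) ≤ N A + N B)
    (hN_def : ∀ A : Matrix (Fin m) (Fin n) ℝ, N A = 0 → A = 0)
    (φ : (Fin m → ℝ) → ℝ)
    (hφ_homog : ∀ (a : ℝ) (u : Fin m → ℝ), φ (a • u) = |a| * φ u)
    (hφ_tri : ∀ u v : Fin m → ℝ, φ (u + v) ≤ φ u + φ v)
    (hφ_def : ∀ u : Fin m → ℝ, φ u = 0 → u = 0)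
    (ψ : (Fin n → ℝ) → ℝ)
    (hψ_homog : ∀ (a : ℝ) (u : Fin n → ℝ), ψ (a • u) = |a| * ψ u)
    (hψ_tri : ∀ u v : Fin n → ℝ, ψ (u + v) ≤ ψ u + ψ v)
    (hψ_def : ∀ u : Fin n → ℝ, ψ u = 0 → u = 0)
    (hsep : ∀ (u : Fin m → ℝ) (v : Fin n → ℝ),
      matDualNorm N (Matrix.vecMulVec u v) = φ u * ψ v)
    (f : (Fin m → ℝ) → ℝ) (lam : ℝ) (hlam : 0 < lam)
    (z : Fin m → ℝ) (β : Fin n → ℝ) (hβ : β ≠ 0) :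
    sSup {t : ℝ | ∃ Δ : Matrix (Fin m) (Fin n) ℝ, N Δ ≤ lam ∧ t = f (z + Δ.mulVec β)} =
      sSup {t : ℝ | ∃ u : Fin m → ℝ, vecDualNorm φ u ≤ lam * ψ β ∧ t = f (z + u)} := by
  have hset : ∀ u : Fin m → ℝ,
      (∃ Δ : Matrix (Fin m) (Fin n) ℝ, N Δ ≤ lam ∧ Δ *ᵥ β = u) ↔
        vecDualNorm φ u ≤ lam * ψ β := by
    let := Matrix.normedAddCommGroup (m := Fin m) (n := Fin n) (α := ℝ)
    let := Matrix.normedSpace (m := Fin m) (n := Fin n) (α := ℝ) (R := ℝ)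
    let pN : Seminorm ℝ (Matrix (Fin m) (Fin n) ℝ) := Seminorm.of N hN_tri hN_homog
    let pφ : Seminorm ℝ (Fin m → ℝ) := Seminorm.of φ hφ_tri hφ_homog
    have hψ_nonneg : 0 ≤ ψ β := apply_nonneg (Seminorm.of ψ hψ_tri hψ_homog) β
    intro u
    constructor
    · rintro ⟨Δ, hΔ, rfl⟩
      refine csSup_le ⟨_, 0, ((map_zero pφ).trans_le zero_le_one : φ 0 ≤ 1), rfl⟩ ?_
      rintro _ ⟨μ, hμ, rfl⟩
      have h : trace ((vecMulVec μ β)ᵀ * Δ) ≤ matDualNorm N (vecMulVec μ β) * N Δ :=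
        pN.linearMap_le_sSup_mul hN_def
          (traceLinearMap (Fin n) ℝ ℝ ∘ₗ mulLeftLinearMap (Fin n) ℝ (vecMulVec μ β)ᵀ) Δ
      rw [trace_transpose_vecMulVec_mul, hsep] at h
      calc _ ≤ φ μ * ψ β * N Δ := h
        _ ≤ 1 * ψ β * lam := by
          have : 0 ≤ N Δ := apply_nonneg pN Δ
          gcongr
        _ = lam * ψ β := by ring
    · intro hu
      by_contra hnot
      have hball : IsCompact {Δ | pN Δ ≤ lam} := pN.isCompact_setOf_le_of_definite hN_def lam
      have hconv : Convex ℝ {Δ | pN Δ ≤ lam} := by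
        simpa using pN.convexOn.convex_le lam
      let T : Matrix (Fin m) (Fin n) ℝ →ₗ[ℝ] (Fin m → ℝ) := (mulVecBilin ℝ ℝ).flip β
      have hT : Continuous T := T.continuous_of_finiteDimensional
      obtain ⟨g, s, hg, hs⟩ := geometric_hahn_banach_closed_point
        (hconv.linear_image T) (hball.image hT).isClosed (x := u) hnot
      let μ : Fin m → ℝ := fun i => g (Pi.single i 1)
      have hgμ : ∀ w, g w = ∑ i, μ i * w i := fun w => by
        conv_lhs => rw [pi_eq_sum_univ' w]
        simp [μ, mul_comm]
      have hle : matDualNorm N (vecMulVec μ β) ≤ s / lam := by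
        refine csSup_le ⟨_, 0, ((map_zero pN).trans_le zero_le_one : N 0 ≤ 1), rfl⟩ ?_
        rintro _ ⟨Δ, hΔ, rfl⟩
        have hmem : N (lam • Δ) ≤ lam := by
          rw [hN_homog, abs_of_pos hlam]
          exact mul_le_of_le_one_right hlam.le hΔ
        have h : g ((lam • Δ) *ᵥ β) < s := hg _ ⟨lam • Δ, hmem, rfl⟩
        rw [smul_mulVec, map_smul, smul_eq_mul, hgμ] at h
        rw [trace_transpose_vecMulVec_mul, le_div_iff₀ hlam, mul_comm]
        exact h.le
      rw [hsep, le_div_iff₀ hlam] at hle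
      have h : ∑ i, μ i * u i ≤ vecDualNorm φ u * φ μ :=
        pφ.linearMap_le_sSup_mul hφ_def ((dotProductBilin ℝ ℝ).flip u) μ
      have h' : vecDualNorm φ u * φ μ ≤ lam * ψ β * φ μ := by
        have : 0 ≤ φ μ := apply_nonneg pφ μ
        gcongr
      rw [hgμ] at hs
      linarith
  congr 1
  ext t
  simp only [← hset, Set.mem_ofPred_eq]
  constructor
  · rintro ⟨Δ, hΔ, rfl⟩
    exact ⟨_, ⟨Δ, hΔ, rfl⟩, rfl⟩
  · rintro ⟨_, ⟨Δ, hΔ, rfl⟩, rfl⟩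
    exact ⟨Δ, hΔ, rfl⟩
end

section
/- Let g : ℝ^{m×n} → ℝ be a seminorm on the space of m×n real matrices that is not identically zero, let h : ℝ^{m×n} → ℝ be a norm, and let λ > 0. Then for every Y, X ∈ ℝ^{m×n}, the supremum of g(Y − X − Δ(X)) over all linear maps Δ : ℝ^{m×n} → ℝ^{m×n} satisfying g(Δ(Z)) ≤ λ·h(Z) for all Z ∈ ℝ^{m×n} equals g(Y − X) + λ·h(X), and this supremum is attained. -/
open scoped ENNReal

theorem Seminorm.exists_dual_le_apply_eq {E : Type*} [AddCommGroup E] [Module ℝ E]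
    (p : Seminorm ℝ E) (x : E) :
    ∃ f : E →ₗ[ℝ] ℝ, f x = p x ∧ ∀ z, |f z| ≤ p z := by
  by_cases hx : x = 0
  · exact ⟨0, by simp [hx], fun z => by simp⟩
  obtain ⟨f, hf, hfp⟩ := exists_extension_of_le_sublinear
    (LinearPMap.mkSpanSingleton x (p x) hx) p
    (fun c hc z => by rw [map_smul_eq_mul, Real.norm_of_nonneg hc.le])
    (map_add_le_add p) (by
      rintro ⟨z, hz⟩
      obtain ⟨c, rfl⟩ := Submodule.mem_span_singleton.1 hz
      rw [LinearPMap.mkSpanSingleton'_apply, map_smul_eq_mul, smul_eq_mul]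
      exact mul_le_mul_of_nonneg_right (le_abs_self c) (apply_nonneg p x))
  refine ⟨f, ?_, fun z => abs_le'.2 ⟨hfp z, ?_⟩⟩
  · have := hf ⟨x, Submodule.mem_span_singleton_self x⟩
    rw [this]
    exact LinearPMap.mkSpanSingleton_apply ℝ ℝ hx (p x)
  · simpa using hfp (-z)

/-- A unit direction along which the seminorm grows linearly from `v`. -/
theorem Seminorm.exists_apply_add_smul_eq {E : Type*} [AddCommGroup E] [Module ℝ E]
    (p : Seminorm ℝ E) (hp : ∃ a, p a ≠ 0) (v : E) :
    ∃ w, p w = 1 ∧ ∀ c : ℝ, 0 ≤ c → p (v + c • w) = p v + c := by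
  have normalize : ∀ a, p a ≠ 0 → p ((p a)⁻¹ • a) = 1 := fun a ha => by
    rw [map_smul_eq_mul, norm_inv, Real.norm_of_nonneg (apply_nonneg p a), inv_mul_cancel₀ ha]
  by_cases hv : p v = 0
  · obtain ⟨a, ha⟩ := hp
    refine ⟨_, normalize a ha, fun c hc => ?_⟩
    set w := (p a)⁻¹ • a with hw
    have hcw : p (c • w) = c := by
      rw [map_smul_eq_mul, normalize a ha, Real.norm_of_nonneg hc, mul_one]
    have upper := map_add_le_add p v (c • w)
    have lower := map_sub_le_add p (v + c • w) v
    rw [add_sub_cancel_left] at lower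
    linarith
  · refine ⟨_, normalize v hv, fun c hc => ?_⟩
    have hpv := apply_nonneg p v
    have : v + c • (p v)⁻¹ • v = (1 + c * (p v)⁻¹) • v := by module
    rw [this, map_smul_eq_mul, Real.norm_of_nonneg (by positivity)]
    field_simp

/-- Matrix analogue: robustification under an induced (h,g) uncertainty set of linear
maps on matrices equals regularization, and the supremum is attained. -/
theorem stmt17 {m n : ℕ} (g h : Matrix (Fin m) (Fin n) ℝ → ℝ) (lam : ℝ) (hlam : 0 < lam)
    (hg_homog : ∀ (a : ℝ) (A : Matrix (Fin m) (Fin n) ℝ), g (a • A) = |a| * g A)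
    (hg_tri : ∀ A B : Matrix (Fin m) (Fin n) ℝ, g (A + B) ≤ g A + g B)
    (hg_ne : ∃ A : Matrix (Fin m) (Fin n) ℝ, g A ≠ 0)
    (hh_homog : ∀ (a : ℝ) (A : Matrix (Fin m) (Fin n) ℝ), h (a • A) = |a| * h A)
    (hh_tri : ∀ A B : Matrix (Fin m) (Fin n) ℝ, h (A + B) ≤ h A + h B)
    (hh_def : ∀ A : Matrix (Fin m) (Fin n) ℝ, h A = 0 → A = 0)
    (Y X : Matrix (Fin m) (Fin n) ℝ) :
    IsGreatest
      {t : ℝ | ∃ Δ : Matrix (Fin m) (Fin n) ℝ →ₗ[ℝ] Matrix (Fin m) (Fin n) ℝ,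
        (∀ Z : Matrix (Fin m) (Fin n) ℝ, g (Δ Z) ≤ lam * h Z) ∧ t = g (Y - X - Δ X)}
      (g (Y - X) + lam * h X) := by
  let p : Seminorm ℝ (Matrix (Fin m) (Fin n) ℝ) := Seminorm.of g hg_tri hg_homog
  let q : Seminorm ℝ (Matrix (Fin m) (Fin n) ℝ) := Seminorm.of h hh_tri hh_homog
  constructor
  · obtain ⟨f, hfX, hf⟩ := q.exists_dual_le_apply_eq X
    obtain ⟨W, hW, hadd⟩ := p.exists_apply_add_smul_eq hg_ne (Y - X)
    change f X = h X at hfX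
    change ∀ Z, |f Z| ≤ h Z at hf
    change g W = 1 at hW
    change ∀ c : ℝ, 0 ≤ c → g (Y - X + c • W) = g (Y - X) + c at hadd
    refine ⟨-(lam • f.smulRight W), fun Z => ?_, ?_⟩
    · have : (-(lam • f.smulRight W)) Z = (-(lam * f Z)) • W := by
        simp [smul_smul]
      rw [this, hg_homog, hW, abs_neg, abs_mul, abs_of_pos hlam, mul_one]
      exact mul_le_mul_of_nonneg_left (hf Z) hlam.le
    · have : Y - X - (-(lam • f.smulRight W)) X = Y - X + (lam * h X) • W := by
        simp [smul_smul, hfX]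
      have hX : 0 ≤ h X := apply_nonneg q X
      rw [this, hadd _ (mul_nonneg hlam.le hX)]
  · rintro t ⟨Δ, hΔ, rfl⟩
    exact (map_sub_le_add p (Y - X) (Δ X)).trans (add_le_add_right (hΔ X) (g (Y - X)))
end
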